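/- There is no map φ defined on all bounded sequences x : ℕ → ℝ that is simultaneously: additive (φ(x+y)=φ(x)+φ(y)); multiplicative (φ(x·y)=φ(x)·φ(y)); a limit operation, i.e. liminf_{n→∞} x(n) ≤ φ(x) ≤ limsup_{n→∞} x(n) for every bounded x; and shift-invariant, i.e. φ(n ↦ x(n+1)) = φ(x) for every bounded x. -/

import Mathlib

/-- There is no additive, multiplicative, shift-invariant limit
operation on the bounded real sequences. -/
theorem no_multiplicative_shift_invariant_limit_operation :
    ¬ ∃ φ : (ℕ → ℝ) → ℝ,
      (∀ x y : ℕ → ℝ, (∃ C : ℝ, ∀ n, |x n| ≤ C) → (∃ C : ℝ, ∀ n, |y n| ≤ C) →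
        φ (x + y) = φ x + φ y) ∧
      (∀ x y : ℕ → ℝ, (∃ C : ℝ, ∀ n, |x n| ≤ C) → (∃ C : ℝ, ∀ n, |y n| ≤ C) →
        φ (x * y) = φ x * φ y) ∧
      (∀ x : ℕ → ℝ, (∃ C : ℝ, ∀ n, |x n| ≤ C) →
        Filter.liminf x Filter.atTop ≤ φ x ∧ φ x ≤ Filter.limsup x Filter.atTop) ∧
      (∀ x : ℕ → ℝ, (∃ C : ℝ, ∀ n, |x n| ≤ C) →
        φ (fun n => x (n + 1)) = φ x) := by
  rintro ⟨φ, hadd, hmul, hlim, hshift⟩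
  have hconst (c : ℝ) : φ (fun _ => c) = c := by
    have h := hlim (fun _ => c) ⟨|c|, fun _ => le_rfl⟩
    rw [Filter.liminf_const, Filter.limsup_const] at h
    exact le_antisymm h.2 h.1
  let s : ℕ → ℝ := fun n => (-1) ^ n
  have hs : ∃ C : ℝ, ∀ n, |s n| ≤ C := ⟨1, fun n => by simp [s]⟩
  have hs' : ∃ C : ℝ, ∀ n, |s (n + 1)| ≤ C := ⟨1, fun n => by simp [s]⟩
  have hsum : s + (fun n => s (n + 1)) = fun _ => 0 := by
    funext n
    simp [s, pow_succ]
  have hsq : s * s = fun _ => 1 := by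
    funext n
    simp [s, ← mul_pow]
  have h0 := hadd s (fun n => s (n + 1)) hs hs'
  have h1 := hmul s s hs hs
  rw [hsum, hconst, hshift s hs] at h0
  rw [hsq, hconst] at h1
  have hφs : φ s = 0 := by linarith
  simp [hφs] at h1
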